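/- Let X be a standard Gaussian random variable (density (2π)^{−1/2}e^{−x²/2} on ℝ) and let Y be a semicircular random variable with density (2/π)√(1−x²) on [−1,1]. Define the operator S f(x) = (1−x²)f^{(5)}(x) + (x³−4x)f^{(4)}(x) + (5−2x²)f^{(3)}(x) + (3x³−21x)f''(x) + 9x² f'(x) − 9x f(x), acting on the class F of all f ∈ C⁵(ℝ) satisfying E[|X^j f^{(t)}(X)|] < ∞ and E[|Y^j f^{(t)}(Y)|] < ∞ for all t = 0, …, 5 and j = 0, …, 3. If W is a real-valued random variable with E[W²] = 1/4 such that E[S f(W)] = 0 for all f ∈ F, then W has the semicircular distribution. -/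

import Mathlib

open MeasureTheory ProbabilityTheory Filter Set
open scoped Topology

open MeasureTheory ProbabilityTheory Filter Set
open scoped Topology

/-- The standard Gaussian distribution, with density `(2π)^(-1/2) exp(-x²/2)` on `ℝ`. -/
noncomputable def stdGaussian : Measure ℝ :=
  volume.withDensity fun x =>
    ENNReal.ofReal ((Real.sqrt (2 * Real.pi))⁻¹ * Real.exp (-x ^ 2 / 2))

/-- The semicircular distribution, with density `(2/π) √(1 - x²)` on `[-1, 1]`. -/
noncomputable def semicircle : Measure ℝ :=
  volume.withDensity fun x =>
    ENNReal.ofReal (Set.indicator (Set.Icc (-1 : ℝ) 1)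
      (fun x => (2 / Real.pi) * Real.sqrt (1 - x ^ 2)) x)

/-- The operator
`S f x = (1-x²) f⁽⁵⁾ + (x³-4x) f⁽⁴⁾ + (5-2x²) f⁽³⁾ + (3x³-21x) f'' + 9x² f' - 9x f`. -/
noncomputable def steinGS (f : ℝ → ℝ) (x : ℝ) : ℝ :=
  (1 - x ^ 2) * iteratedDeriv 5 f x + (x ^ 3 - 4 * x) * iteratedDeriv 4 f x
    + (5 - 2 * x ^ 2) * iteratedDeriv 3 f x + (3 * x ^ 3 - 21 * x) * iteratedDeriv 2 f x
    + 9 * x ^ 2 * deriv f x - 9 * x * f x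

/-- Membership in the class F: `f ∈ C⁵(ℝ)` with `E|X^j f^(t)(X)| < ∞` and
`E|Y^j f^(t)(Y)| < ∞` for all `t = 0,…,5` and `j = 0,…,3`, where `X` is standard
Gaussian and `Y` is semicircular. -/
def memFGS (f : ℝ → ℝ) : Prop :=
  ContDiff ℝ 5 f ∧
    (∀ t ≤ 5, ∀ j ≤ 3,
      Integrable (fun x => x ^ j * iteratedDeriv t f x) stdGaussian) ∧
    (∀ t ≤ 5, ∀ j ≤ 3,
      Integrable (fun x => x ^ j * iteratedDeriv t f x) semicircle)


lemma semi_meas : Measurable (fun x : ℝ => ENNReal.ofReal (Set.indicator (Set.Icc (-1 : ℝ) 1)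
      (fun x => (2 / Real.pi) * Real.sqrt (1 - x ^ 2)) x)) := by
  apply ENNReal.measurable_ofReal.comp
  apply Measurable.indicator _ measurableSet_Icc
  fun_prop

lemma semi_dens (x : ℝ) : (ENNReal.ofReal (Set.indicator (Set.Icc (-1 : ℝ) 1)
      (fun x => (2 / Real.pi) * Real.sqrt (1 - x ^ 2)) x)).toReal
      = Set.indicator (Set.Icc (-1 : ℝ) 1)
      (fun x => (2 / Real.pi) * Real.sqrt (1 - x ^ 2)) x := by
  apply ENNReal.toReal_ofReal
  apply Set.indicator_nonneg
  intro x _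
  positivity

lemma semi_integrable {g : ℝ → ℝ} (hg : Continuous g) : Integrable g semicircle := by
  unfold semicircle
  rw [integrable_withDensity_iff_integrable_smul' semi_meas (by simp)]
  simp only [semi_dens, smul_eq_mul]
  have : (fun x => Set.indicator (Set.Icc (-1 : ℝ) 1)
      (fun x => (2 / Real.pi) * Real.sqrt (1 - x ^ 2)) x * g x) =
      Set.indicator (Set.Icc (-1 : ℝ) 1)
      (fun x => (2 / Real.pi) * Real.sqrt (1 - x ^ 2) * g x) := by
    ext x
    by_cases hx : x ∈ Set.Icc (-1 : ℝ) 1 <;> simp [hx]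
  rw [this, integrable_indicator_iff measurableSet_Icc]
  apply ContinuousOn.integrableOn_Icc
  fun_prop

lemma semi_integral (g : ℝ → ℝ) : ∫ x, g x ∂semicircle
    = ∫ x in (-1 : ℝ)..1, (2 / Real.pi) * (Real.sqrt (1 - x ^ 2) * g x) := by
  unfold semicircle
  rw [integral_withDensity_eq_integral_toReal_smul semi_meas (by simp)]
  simp only [semi_dens, smul_eq_mul]
  have : (fun x => Set.indicator (Set.Icc (-1 : ℝ) 1)
      (fun x => (2 / Real.pi) * Real.sqrt (1 - x ^ 2)) x * g x) =
      Set.indicator (Set.Icc (-1 : ℝ) 1)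
      (fun x => (2 / Real.pi) * (Real.sqrt (1 - x ^ 2) * g x)) := by
    ext x
    by_cases hx : x ∈ Set.Icc (-1 : ℝ) 1 <;> simp [hx, mul_assoc]
  rw [this, integral_indicator measurableSet_Icc, intervalIntegral.integral_of_le (by norm_num),
    integral_Icc_eq_integral_Ioc]

lemma semi_one : ∫ _x, (1 : ℝ) ∂semicircle = 1 := by
  rw [semi_integral]
  simp only [mul_one]
  rw [intervalIntegral.integral_const_mul, integral_sqrt_one_sub_sq]
  have := Real.pi_ne_zero
  field_simp

instance semi_prob : IsProbabilityMeasure semicircle := by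
  have h1 : Integrable (fun _ : ℝ => (1 : ℝ)) semicircle := semi_integrable continuous_const
  have hf : IsFiniteMeasure semicircle := by
    rw [integrable_const_iff] at h1
    simpa using h1
  have h2 := semi_one
  simp only [integral_const, smul_eq_mul, mul_one] at h2
  constructor
  rw [Measure.real, ENNReal.toReal_eq_one_iff] at h2
  exact h2

lemma semi_supp : ∀ᵐ x ∂semicircle, x ∈ Set.Icc (-1 : ℝ) 1 := by
  unfold semicircle
  rw [ae_withDensity_iff semi_meas]
  refine Filter.Eventually.of_forall fun x hx => ?_
  by_contra h
  simp [Set.indicator_of_notMem h] at hx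

lemma semi_stein {h h' : ℝ → ℝ} (hh : ∀ x, HasDerivAt h (h' x) x) (hc : Continuous h') :
    ∫ x, ((1 - x ^ 2) * h' x - 3 * x * h x) ∂semicircle = 0 := by
  have hcont : Continuous h := continuous_iff_continuousAt.2 fun x => (hh x).continuousAt
  rw [semi_integral, intervalIntegral.integral_const_mul]
  have := intervalIntegral.integral_eq_sub_of_hasDerivAt_of_le (a := -1) (b := 1)
    (f := fun x => (1 - x ^ 2) * Real.sqrt (1 - x ^ 2) * h x)
    (f' := fun x => Real.sqrt (1 - x ^ 2) * ((1 - x ^ 2) * h' x - 3 * x * h x)) (by norm_num)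
    (by fun_prop) ?_ ?_
  · rw [this]; simp
  · intro x hx
    have hpos : 0 < 1 - x ^ 2 := by nlinarith [hx.1, hx.2]
    have h1 : HasDerivAt (fun x : ℝ => 1 - x ^ 2) (-(2 * x)) x := by
      have := (hasDerivAt_pow 2 x).const_sub 1
      simpa using this
    have h2 := (h1.mul (h1.sqrt hpos.ne')).mul (hh x)
    refine h2.congr_deriv ?_
    have hs : Real.sqrt (1 - x ^ 2) ≠ 0 := (Real.sqrt_pos.2 hpos).ne'
    have hq : Real.sqrt (1 - x ^ 2) ^ 2 = 1 - x ^ 2 := Real.sq_sqrt hpos.le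
    simp only [Pi.mul_apply]
    generalize Real.sqrt (1 - x ^ 2) = s at hs hq ⊢
    rw [← hq]
    field_simp
    ring
  · apply Continuous.intervalIntegrable
    fun_prop

lemma gauss_eq : _root_.stdGaussian = gaussianReal 0 1 := by
  rw [gaussianReal_of_var_ne_zero _ one_ne_zero]
  unfold _root_.stdGaussian gaussianPDF gaussianPDFReal
  simp

lemma gauss_integrable (N : ℕ) : Integrable (fun x : ℝ => (1 + |x|) ^ N) _root_.stdGaussian := by
  rw [gauss_eq]
  have h1 : MemLp (fun x : ℝ => ‖x‖) (N : ENNReal) (gaussianReal 0 1) :=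
    (memLp_id_gaussianReal' (μ := 0) (v := 1) (N : ENNReal) (by simp)).norm
  have h0 : MemLp (fun _ : ℝ => (1 : ℝ)) (N : ENNReal) (gaussianReal 0 1) := memLp_const 1
  have h := h0.add h1
  have := h.integrable_norm_pow'
  refine this.congr (Filter.Eventually.of_forall fun x => ?_)
  simp only [Real.norm_eq_abs, Pi.add_apply]
  rw [abs_of_nonneg (by positivity : 0 ≤ 1 + |x|)]

/-- Form of the operator on a chain of derivatives. -/
noncomputable def stF (F : ℕ → ℝ → ℝ) (x : ℝ) : ℝ :=
  (1 - x ^ 2) * F 5 x + (x ^ 3 - 4 * x) * F 4 x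
    + (5 - 2 * x ^ 2) * F 3 x + (3 * x ^ 3 - 21 * x) * F 2 x
    + 9 * x ^ 2 * F 1 x - 9 * x * F 0 x

structure Chain (F : ℕ → ℝ → ℝ) : Prop where
  der : ∀ t < 5, ∀ x, HasDerivAt (F t) (F (t + 1) x) x
  cont : ∀ t ≤ 5, Continuous (F t)
  bdd : ∀ t ≤ 5, ∃ (C : ℝ) (N : ℕ), ∀ x, |F t x| ≤ C * (1 + |x|) ^ N

lemma Chain.iter {F : ℕ → ℝ → ℝ} (h : Chain F) : ∀ t ≤ 5, iteratedDeriv t (F 0) = F t := by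
  intro t
  induction t with
  | zero => intro _; simp
  | succ t ih =>
    intro ht
    rw [iteratedDeriv_succ, ih (by omega)]
    ext x
    exact (h.der t (by omega) x).deriv

lemma Chain.stein {F : ℕ → ℝ → ℝ} (h : Chain F) : steinGS (F 0) = stF F := by
  ext x
  unfold steinGS stF
  rw [h.iter 5 (by norm_num), h.iter 4 (by norm_num), h.iter 3 (by norm_num),
    h.iter 2 (by norm_num), (h.der 0 (by norm_num) x).deriv]

lemma Chain.mem {F : ℕ → ℝ → ℝ} (h : Chain F) : memFGS (F 0) := by
  refine ⟨?_, ?_, ?_⟩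
  · have := (contDiff_nat_iff_iteratedDeriv (𝕜 := ℝ) (n := 5) (f := F 0)).2 ⟨?_, ?_⟩
    · exact_mod_cast this
    · intro m hm
      rw [h.iter m hm]; exact h.cont m hm
    · intro m hm
      rw [h.iter m hm.le]; exact fun x => (h.der m hm x).differentiableAt
  · intro t ht j hj
    rw [h.iter t ht]
    obtain ⟨C, N, hC⟩ := h.bdd t ht
    have hc := h.cont t ht
    refine ((gauss_integrable (j + N)).const_mul C).mono' (by fun_prop) ?_
    refine Filter.Eventually.of_forall fun x => ?_
    rw [Real.norm_eq_abs, abs_mul, abs_pow, pow_add]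
    have : |x| ^ j ≤ (1 + |x|) ^ j := by gcongr; linarith [abs_nonneg x]
    calc |x| ^ j * |F t x| ≤ (1 + |x|) ^ j * (C * (1 + |x|) ^ N) := by
          gcongr; exact hC x
      _ = _ := by ring
  · intro t ht j hj
    rw [h.iter t ht]
    have hc := h.cont t ht
    exact semi_integrable (by fun_prop)

lemma Chain.semi {F : ℕ → ℝ → ℝ} (h : Chain F) : ∫ x, stF F x ∂semicircle = 0 := by
  have c0 := h.cont 0 (by norm_num)
  have c1 := h.cont 1 (by norm_num)
  have c2 := h.cont 2 (by norm_num)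
  have c3 := h.cont 3 (by norm_num)
  have c4 := h.cont 4 (by norm_num)
  have c5 := h.cont 5 (by norm_num)
  rw [← semi_stein (h := fun x => F 4 x - x * F 3 x + 6 * F 2 x - 3 * (x * F 1 x) + 3 * F 0 x)
    (h' := fun x => F 5 x - (F 3 x + x * F 4 x) + 6 * F 3 x - 3 * (F 1 x + x * F 2 x) + 3 * F 1 x)
    ?_ (by fun_prop)]
  · congr 1
    ext x
    unfold stF
    ring
  · intro x
    have d0 := h.der 0 (by norm_num) x
    have d1 := h.der 1 (by norm_num) x
    have d2 := h.der 2 (by norm_num) x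
    have d3 := h.der 3 (by norm_num) x
    have d4 := h.der 4 (by norm_num) x
    have e3 := (hasDerivAt_id' x).mul d3
    have e1 := (hasDerivAt_id' x).mul d1
    have := (((d4.sub e3).add (d2.const_mul 6)).sub (e1.const_mul 3)).add (d0.const_mul 3)
    refine this.congr_deriv ?_
    simp

noncomputable def powF (n : ℕ) (t : ℕ) (x : ℝ) : ℝ := (n.descFactorial t : ℝ) * x ^ (n - t)

lemma powF_chain (n : ℕ) : Chain (powF n) := by
  refine ⟨?_, ?_, ?_⟩
  · intro t _ x
    have := (hasDerivAt_pow (n - t) x).const_mul (n.descFactorial t : ℝ)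
    refine this.congr_deriv ?_
    unfold powF
    rw [Nat.descFactorial_succ, Nat.sub_sub]
    push_cast
    ring
  · intro t _
    unfold powF
    fun_prop
  · intro t _
    refine ⟨n.descFactorial t, n - t, fun x => ?_⟩
    unfold powF
    rw [abs_mul, abs_pow, Nat.abs_cast]
    gcongr
    linarith [abs_nonneg x]

lemma powF_int (ρ : Measure ℝ) (hρ : ∀ n : ℕ, Integrable (fun x : ℝ => x ^ n) ρ) (n : ℕ) :
    ∃ (c : Fin 10 → ℝ) (e : Fin 10 → ℕ),
    c = ![(n.descFactorial 5 : ℝ), - n.descFactorial 5, n.descFactorial 4, -4 * n.descFactorial 4,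
      5 * n.descFactorial 3, -2 * n.descFactorial 3, 3 * n.descFactorial 2,
      -21 * n.descFactorial 2, 9 * n.descFactorial 1, -9] ∧
    e = ![n - 5, n - 5 + 2, n - 4 + 3, n - 4 + 1, n - 3, n - 3 + 2, n - 2 + 3, n - 2 + 1,
      n - 1 + 2, n + 1] ∧
    ∫ x, stF (powF n) x ∂ρ = ∑ i, c i * ∫ x, x ^ e i ∂ρ := by
  refine ⟨_, _, rfl, rfl, ?_⟩
  have : ∀ x, stF (powF n) x = ∑ i : Fin 10, (![(n.descFactorial 5 : ℝ), - n.descFactorial 5,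
      n.descFactorial 4, -4 * n.descFactorial 4,
      5 * n.descFactorial 3, -2 * n.descFactorial 3, 3 * n.descFactorial 2,
      -21 * n.descFactorial 2, 9 * n.descFactorial 1, -9] i : ℝ) *
      x ^ (![n - 5, n - 5 + 2, n - 4 + 3, n - 4 + 1, n - 3, n - 3 + 2, n - 2 + 3, n - 2 + 1,
      n - 1 + 2, n + 1] i) := by
    intro x
    simp only [Fin.sum_univ_succ, stF, powF]
    simp
    ring
  simp only [this]
  rw [integral_finsetSum _ (fun i _ => (hρ _).const_mul _)]
  simp only [integral_const_mul]

lemma moments_eq (μ : Measure ℝ) [IsProbabilityMeasure μ]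
    (hint : ∀ n : ℕ, Integrable (fun x : ℝ => x ^ n) μ)
    (h2 : ∫ x, x ^ 2 ∂μ = 1 / 4)
    (hS : ∀ f, memFGS f → ∫ x, steinGS f x ∂μ = 0) (n : ℕ) :
    ∫ x, x ^ n ∂μ = ∫ x, x ^ n ∂semicircle := by
  have hs : ∀ n : ℕ, Integrable (fun x : ℝ => x ^ n) semicircle :=
    fun n => semi_integrable (by fun_prop)
  have key : ∀ n : ℕ, ∫ x, stF (powF n) x ∂μ = 0 := by
    intro n
    rw [← (powF_chain n).stein]
    exact hS _ (powF_chain n).mem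
  have key' : ∀ n : ℕ, ∫ x, stF (powF n) x ∂semicircle = 0 := fun n => (powF_chain n).semi
  set D : ℕ → ℝ := fun n => ∫ x, x ^ n ∂μ - ∫ x, x ^ n ∂semicircle with hD
  suffices D n = 0 by simpa [hD, sub_eq_zero] using this
  have hrec : ∀ n : ℕ, (n.descFactorial 5 : ℝ) * D (n - 5) - n.descFactorial 5 * D (n - 5 + 2)
      + n.descFactorial 4 * D (n - 4 + 3) - 4 * n.descFactorial 4 * D (n - 4 + 1)
      + 5 * n.descFactorial 3 * D (n - 3) - 2 * n.descFactorial 3 * D (n - 3 + 2)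
      + 3 * n.descFactorial 2 * D (n - 2 + 3) - 21 * n.descFactorial 2 * D (n - 2 + 1)
      + 9 * n.descFactorial 1 * D (n - 1 + 2) - 9 * D (n + 1) = 0 := by
    intro n
    obtain ⟨c, e, hc, he, h⟩ := powF_int μ hint n
    obtain ⟨c', e', hc', he', h'⟩ := powF_int semicircle hs n
    rw [key] at h
    rw [key'] at h'
    rw [← hc] at hc'
    rw [← he] at he'
    subst hc' he'
    have hsum : ∑ i, c' i * D (e' i) = 0 := by
      simp only [hD, mul_sub, Finset.sum_sub_distrib]
      rw [← h, ← h']; simp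
    rw [← hsum, hc, he]
    simp only [Fin.sum_univ_succ]
    simp
    ring
  have D0 : D 0 = 0 := by simp [hD]
  have D1 : D 1 = 0 := by
    have := hrec 0
    simp at this
    exact this
  have D2 : D 2 = 0 := by
    have s1 := semi_stein (h := fun x => x) (h' := fun _ => 1) (fun x => hasDerivAt_id' x)
      continuous_const
    have : ∀ x : ℝ, (1 - x ^ 2) * 1 - 3 * x * x = 1 - 4 * x ^ 2 := fun x => by ring
    simp only [this] at s1
    rw [integral_sub (integrable_const _) ((hs 2).const_mul 4), semi_one, integral_const_mul] at s1
    simp only [hD, h2]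
    linarith
  induction n using Nat.strong_induction_on with
  | _ n ih =>
    rcases n with _ | _ | _ | k
    · exact D0
    · exact D1
    · exact D2
    · have r := hrec (k + 2)
      rw [ih (k + 2 - 5) (by omega), ih (k + 2 - 5 + 2) (by omega), ih (k + 2 - 4 + 1) (by omega),
        ih (k + 2 - 3) (by omega), ih (k + 2 - 3 + 2) (by omega), ih (k + 2 - 2 + 1) (by omega)] at r
      have h4 : ((k + 2).descFactorial 4 : ℝ) * D (k + 2 - 4 + 3) = 0 := by
        rcases lt_or_ge k 1 with hk | hk
        · have : (k + 2).descFactorial 4 = 0 := by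
            rw [Nat.descFactorial_eq_zero_iff_lt]; omega
          rw [this]; simp
        · rw [ih (k + 2 - 4 + 3) (by omega)]; simp
      rw [h4] at r
      have e1 : k + 2 - 2 + 3 = k + 1 + 1 + 1 := by omega
      have e2 : k + 2 - 1 + 2 = k + 1 + 1 + 1 := by omega
      have e3 : k + 2 + 1 = k + 1 + 1 + 1 := by omega
      rw [e1, e2, e3] at r
      have a2 : ((k + 2).descFactorial 2 : ℝ) = (k + 2) * (k + 1) := by
        have : (k + 2).descFactorial 2 = (k + 1) * (k + 2) := by
          simp [Nat.descFactorial_succ]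
        rw [this]; push_cast; ring
      have a1 : ((k + 2).descFactorial 1 : ℝ) = k + 2 := by
        simp
      rw [a2, a1] at r
      have : (3 * ((k : ℝ) + 5) * (k + 1)) * D (k + 1 + 1 + 1) = 0 := by
        linear_combination r
      rcases mul_eq_zero.1 this with h | h
      · have : (0 : ℝ) < 3 * ((k : ℝ) + 5) * (k + 1) := by positivity
        linarith
      · exact h

lemma determine (μ : Measure ℝ) [IsProbabilityMeasure μ]
    (hint : ∀ n : ℕ, Integrable (fun x : ℝ => x ^ n) μ)
    (hm : ∀ n : ℕ, ∫ x, x ^ n ∂μ = ∫ x, x ^ n ∂semicircle) : μ = semicircle := by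
  have hs : ∀ n : ℕ, Integrable (fun x : ℝ => x ^ n) semicircle :=
    fun n => semi_integrable (by fun_prop)
  have hle : ∀ n : ℕ, ∫ x, x ^ (2 * n) ∂μ ≤ 1 := by
    intro n
    rw [hm, ← semi_one]
    apply integral_mono_ae (hs _) (integrable_const _)
    filter_upwards [semi_supp] with x hx
    rw [pow_mul]
    apply pow_le_one₀ (sq_nonneg x)
    nlinarith [hx.1, hx.2]
  have hr : ∀ r : ℝ, 1 < r → ∀ᵐ x ∂μ, |x| < r := by
    intro r hr
    rw [ae_iff]
    have hb : ∀ n : ℕ, μ.real {x | ¬ |x| < r} ≤ ((r ^ 2)⁻¹) ^ n := by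
      intro n
      have h1 := mul_meas_ge_le_integral_of_nonneg (μ := μ) (f := fun x : ℝ => x ^ (2 * n))
        (Filter.Eventually.of_forall fun x => by
          simp only [Pi.zero_apply]; rw [pow_mul]; positivity) (hint _) (r ^ (2 * n))
      have h2 : μ.real {x | ¬ |x| < r} ≤ μ.real {x | r ^ (2 * n) ≤ x ^ (2 * n)} := by
        apply measureReal_mono
        · intro x hx
          simp only [mem_ofPred_eq, not_lt] at hx ⊢
          have : x ^ (2 * n) = |x| ^ (2 * n) := by rw [pow_mul, pow_mul, sq_abs]
          rw [this]
          gcongr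
        · exact measure_ne_top _ _
      have hp : 0 < r ^ (2 * n) := by positivity
      rw [inv_pow, ← pow_mul, ← one_div, le_div_iff₀ hp]
      have := hle n
      nlinarith
    have hlim : Tendsto (fun n : ℕ => ((r ^ 2)⁻¹) ^ n) atTop (𝓝 0) := by
      apply tendsto_pow_atTop_nhds_zero_of_lt_one (by positivity)
      apply inv_lt_one_of_one_lt₀
      nlinarith
    have h0 : μ.real {x | ¬ |x| < r} ≤ 0 := ge_of_tendsto' hlim hb
    have h1 := le_antisymm h0 measureReal_nonneg
    exact (measureReal_eq_zero_iff).1 h1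
  have hsupp : ∀ᵐ x ∂μ, x ∈ Set.Icc (-1 : ℝ) 1 := by
    have : ∀ᵐ x ∂μ, ∀ n : ℕ, |x| < 1 + 1 / ((n : ℝ) + 1) := by
      rw [ae_all_iff]
      intro n
      apply hr
      have : (0 : ℝ) < 1 / ((n : ℝ) + 1) := by positivity
      linarith
    filter_upwards [this] with x hx
    rw [Set.mem_Icc, ← abs_le]
    have hl : Tendsto (fun n : ℕ => 1 + 1 / ((n : ℝ) + 1)) atTop (𝓝 (1 + 0)) :=
      tendsto_const_nhds.add tendsto_one_div_add_atTop_nhds_zero_nat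
    simpa using ge_of_tendsto' hl (fun n => (hx n).le)
  have hpi : ∀ (ρ : Measure ℝ), (∀ n : ℕ, Integrable (fun x : ℝ => x ^ n) ρ) →
      ∀ p : Polynomial ℝ, Integrable (fun x => p.eval x) ρ := by
    intro ρ hρ p
    simp only [Polynomial.eval_eq_sum_range]
    exact integrable_finsetSum _ (fun i _ => (hρ i).const_mul _)
  have hp : ∀ p : Polynomial ℝ, ∫ x, p.eval x ∂μ = ∫ x, p.eval x ∂semicircle := by
    intro p
    simp only [Polynomial.eval_eq_sum_range]
    rw [integral_finsetSum _ (fun i _ => (hint i).const_mul _),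
      integral_finsetSum _ (fun i _ => (hs i).const_mul _)]
    simp only [integral_const_mul, hm]
  apply ext_of_forall_integral_eq_of_IsFiniteMeasure
  intro f
  apply eq_of_abs_sub_le_all
  intro ε hε
  obtain ⟨p, hpf⟩ := exists_polynomial_near_of_continuousOn (-1) 1 f f.continuous.continuousOn
    (ε / 2) (by positivity)
  have hA : ∀ (ρ : Measure ℝ) [IsProbabilityMeasure ρ],
      (∀ n : ℕ, Integrable (fun x : ℝ => x ^ n) ρ) →
      (∀ᵐ x ∂ρ, x ∈ Set.Icc (-1 : ℝ) 1) → |∫ x, p.eval x ∂ρ - ∫ x, f x ∂ρ| ≤ ε / 2 := by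
    intro ρ _ hρ hsu
    rw [← integral_sub (hpi ρ hρ p) (f.integrable ρ)]
    have := norm_integral_le_of_norm_le_const (μ := ρ) (f := fun x => p.eval x - f x) (C := ε / 2)
      (by filter_upwards [hsu] with x hx
          exact (hpf x hx).le)
    simpa using this
  have a1 := abs_le.1 (hA μ hint hsupp)
  have a2 := abs_le.1 (hA semicircle hs semi_supp)
  have a3 := hp p
  rw [abs_le]
  constructor <;> linarith [a1.1, a1.2, a2.1, a2.2]

open Polynomial in
noncomputable def dP (n : ℕ) (P : Polynomial ℝ) : Polynomial ℝ :=
  C (n : ℝ) * P + (2 * X ^ 2 - 2 * X) * derivative P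

noncomputable def vv (ε x : ℝ) : ℝ := (1 + ε * x ^ 2)⁻¹

noncomputable def FP (ε : ℝ) (j : ℕ) (P : Polynomial ℝ) (x : ℝ) : ℝ := x ^ j * P.eval (vv ε x)

lemma vv_pos {ε : ℝ} (hε : 0 < ε) (x : ℝ) : 0 < vv ε x := by unfold vv; positivity

lemma vv_rel {ε : ℝ} (hε : 0 < ε) (x : ℝ) : vv ε x * (ε * x ^ 2) = 1 - vv ε x := by
  unfold vv
  have : 1 + ε * x ^ 2 ≠ 0 := by positivity
  field_simp
  ring

lemma vv_le {ε : ℝ} (hε : 0 < ε) (x : ℝ) : vv ε x ≤ 1 := by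
  have h1 := vv_rel hε x
  have h2 := vv_pos hε x
  have : 0 ≤ vv ε x * (ε * x ^ 2) := by positivity
  linarith

lemma vv_der {ε : ℝ} (hε : 0 < ε) (x : ℝ) :
    HasDerivAt (vv ε) (-(2 * ε * x * vv ε x ^ 2)) x := by
  have h0 : 1 + ε * x ^ 2 ≠ 0 := by positivity
  have h := (((hasDerivAt_pow 2 x).const_mul ε).const_add 1).inv h0
  refine h.congr_deriv ?_
  unfold vv
  field_simp
  simp
  ring

lemma vv_cont {ε : ℝ} (hε : 0 < ε) : Continuous (vv ε) :=
  continuous_iff_continuousAt.2 fun x => (vv_der hε x).continuousAt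

lemma FP_cont {ε : ℝ} (hε : 0 < ε) (j : ℕ) (P : Polynomial ℝ) : Continuous (FP ε j P) := by
  have := vv_cont hε
  have h2 := P.continuous.comp this
  unfold FP
  exact (continuous_pow j).mul h2

lemma FP_der_succ {ε : ℝ} (hε : 0 < ε) (j : ℕ) (P : Polynomial ℝ) (x : ℝ) :
    HasDerivAt (FP ε (j + 1) P) (FP ε j (dP (j + 1) P) x) x := by
  have h1 := (P.hasDerivAt (vv ε x)).comp x (vv_der hε x)
  have h2 := (hasDerivAt_pow (j + 1) x).mul h1
  refine h2.congr_deriv ?_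
  unfold FP
  have hr := vv_rel hε x
  simp only [dP, Polynomial.eval_add, Polynomial.eval_mul, Polynomial.eval_C, Polynomial.eval_sub,
    Polynomial.eval_pow, Polynomial.eval_X, Polynomial.eval_ofNat, Function.comp, Nat.add_sub_cancel]
  push_cast
  linear_combination (-2 * x ^ j * Polynomial.eval (vv ε x) (Polynomial.derivative P) * vv ε x) * hr

lemma FP_der_zero {ε : ℝ} (hε : 0 < ε) (P : Polynomial ℝ) (x : ℝ) :
    HasDerivAt (FP ε 0 P)
      (-(2 * ε) * FP ε 1 (Polynomial.X ^ 2 * Polynomial.derivative P) x) x := by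
  have h1 := (P.hasDerivAt (vv ε x)).comp x (vv_der hε x)
  have : FP ε 0 P = (fun y => P.eval y) ∘ vv ε := by ext y; simp [FP]
  rw [this]
  refine h1.congr_deriv ?_
  simp [FP]
  ring

lemma poly_bdd (P : Polynomial ℝ) : ∃ C : ℝ, 0 ≤ C ∧ ∀ v, 0 ≤ v → v ≤ 1 → |P.eval v| ≤ C := by
  obtain ⟨C, hC⟩ := (isCompact_Icc (a := (0 : ℝ)) (b := 1)).exists_bound_of_continuousOn
    P.continuous.continuousOn
  exact ⟨C, (abs_nonneg _).trans (hC 0 (by simp)), fun v h0 h1 => hC v ⟨h0, h1⟩⟩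

lemma FP_bdd (P : Polynomial ℝ) : ∃ C : ℝ, 0 ≤ C ∧ ∀ ε, 0 < ε → ∀ j x,
    |FP ε j P x| ≤ C * |x| ^ j := by
  obtain ⟨C, h0, hC⟩ := poly_bdd P
  refine ⟨C, h0, fun ε hε j x => ?_⟩
  unfold FP
  rw [abs_mul, abs_pow, mul_comm]
  gcongr
  exact hC _ (vv_pos hε x).le (vv_le hε x)

noncomputable def PP (m : ℕ) : ℕ → Polynomial ℝ
  | 0 => Polynomial.X ^ m
  | t + 1 => dP (2 * m + 1 - t) (PP m t)

noncomputable def QQ : Polynomial ℝ := Polynomial.X ^ 2 * Polynomial.derivative (PP 1 3)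

noncomputable def GG (ε : ℝ) (m t : ℕ) (x : ℝ) : ℝ :=
  if m = 1 ∧ t = 4 then -(2 * ε) * FP ε 1 QQ x
  else if m = 1 ∧ t = 5 then -(2 * ε) * FP ε 0 (dP 1 QQ) x
  else FP ε (2 * m + 1 - t) (PP m t) x

lemma GG_gen {ε : ℝ} {m t : ℕ} (h : 2 ≤ m ∨ t ≤ 3) :
    GG ε m t = FP ε (2 * m + 1 - t) (PP m t) := by
  ext x
  unfold GG
  rw [if_neg (by omega), if_neg (by omega)]

lemma GG_four {ε : ℝ} : GG ε 1 4 = fun x => -(2 * ε) * FP ε 1 QQ x := by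
  ext x; simp [GG]

lemma GG_five {ε : ℝ} : GG ε 1 5 = fun x => -(2 * ε) * FP ε 0 (dP 1 QQ) x := by
  ext x; simp [GG]

lemma FP_bdd' {ε : ℝ} (hε : 0 < ε) (j : ℕ) (P : Polynomial ℝ) (c : ℝ) :
    ∃ (C : ℝ) (N : ℕ), ∀ x, |c * FP ε j P x| ≤ C * (1 + |x|) ^ N := by
  obtain ⟨C, h0, hC⟩ := FP_bdd P
  refine ⟨|c| * C, j, fun x => ?_⟩
  rw [abs_mul, mul_assoc]
  gcongr
  refine (hC ε hε j x).trans ?_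
  gcongr
  linarith [abs_nonneg x]

lemma GG_chain {ε : ℝ} (hε : 0 < ε) {m : ℕ} (hm : 1 ≤ m) : Chain (GG ε m) := by
  have hcase : ∀ t ≤ 5, ∃ c j P, GG ε m t = fun x => c * FP ε j P x := by
    intro t ht
    by_cases h : 2 ≤ m ∨ t ≤ 3
    · exact ⟨1, _, _, by rw [GG_gen h]; simp; rfl⟩
    · have h1 : m = 1 := by omega
      subst h1
      have : t = 4 ∨ t = 5 := by omega
      rcases this with rfl | rfl
      · exact ⟨_, _, _, GG_four⟩
      · exact ⟨_, _, _, GG_five⟩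
  refine ⟨?_, ?_, ?_⟩
  · intro t ht x
    by_cases h : 2 ≤ m ∨ t + 1 ≤ 3
    · rw [GG_gen h, GG_gen (by omega : 2 ≤ m ∨ t ≤ 3)]
      obtain ⟨j, hj⟩ : ∃ j, 2 * m + 1 - t = j + 1 := ⟨2 * m - t, by omega⟩
      have hj' : 2 * m + 1 - (t + 1) = j := by omega
      have := FP_der_succ hε j (PP m t) x
      rw [hj']
      simp only [PP]
      rw [hj]
      exact this
    · have h1 : m = 1 := by omega
      subst h1
      have : t = 3 ∨ t = 4 := by omega
      rcases this with rfl | rfl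
      · rw [GG_four, GG_gen (by omega)]
        exact FP_der_zero hε (PP 1 3) x
      · rw [GG_four, GG_five]
        exact (FP_der_succ hε 0 QQ x).const_mul _
  · intro t ht
    obtain ⟨c, j, P, h⟩ := hcase t ht
    rw [h]
    exact (FP_cont hε j P).const_mul c
  · intro t ht
    obtain ⟨c, j, P, h⟩ := hcase t ht
    rw [h]
    exact FP_bdd' hε j P c

noncomputable def mainT (F : ℕ → ℝ → ℝ) (x : ℝ) : ℝ :=
  3 * x ^ 3 * F 2 x + 9 * x ^ 2 * F 1 x - 9 * x * F 0 x

noncomputable def lowT (F : ℕ → ℝ → ℝ) (x : ℝ) : ℝ :=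
  F 5 x - x ^ 2 * F 5 x + x ^ 3 * F 4 x - 4 * (x ^ 1 * F 4 x)
    + 5 * F 3 x - 2 * (x ^ 2 * F 3 x) - 21 * (x ^ 1 * F 2 x)

lemma stF_split (F : ℕ → ℝ → ℝ) (x : ℝ) : stF F x = mainT F x + lowT F x := by
  unfold stF mainT lowT; ring

lemma GG_main {ε : ℝ} (hε : 0 < ε) {m : ℕ} (hm : 1 ≤ m) (x : ℝ) :
    mainT (GG ε m) x = 12 * m * x ^ (2 * m + 2) * vv ε x ^ (m + 1) * (1 + (m + 1) * vv ε x) := by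
  unfold mainT
  rw [GG_gen (by omega), GG_gen (by omega), GG_gen (by omega)]
  obtain ⟨k, rfl⟩ : ∃ k, m = k + 1 := ⟨m - 1, by omega⟩
  have e0 : 2 * (k + 1) + 1 - 0 = 2 * k + 3 := by omega
  have e1 : 2 * (k + 1) + 1 - 1 = 2 * k + 2 := by omega
  have e2 : 2 * (k + 1) + 1 - 2 = 2 * k + 1 := by omega
  have p0 : (PP (k + 1) 0) = Polynomial.X ^ (k + 1) := rfl
  have p1 : (PP (k + 1) 1) = Polynomial.X ^ (k + 1) +
      Polynomial.C (2 * ((k : ℝ) + 1)) * Polynomial.X ^ (k + 2) := by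
    show dP (2 * (k + 1) + 1 - 0) (PP (k + 1) 0) = _
    rw [p0, e0]
    have c2 : (Polynomial.C (2 : ℝ)) = 2 := rfl
    have c3 : (Polynomial.C (3 : ℝ)) = 3 := rfl
    have c4 : (Polynomial.C (4 : ℝ)) = 4 := rfl
    simp [dP, c2, c3, c4]
    ring
  have p2 : (PP (k + 1) 2) = Polynomial.C (-(2 * ((k : ℝ) + 1))) * Polynomial.X ^ (k + 2) +
      Polynomial.C (4 * ((k : ℝ) + 1) * (k + 2)) * Polynomial.X ^ (k + 3) := by
    show dP (2 * (k + 1) + 1 - 1) (PP (k + 1) 1) = _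
    rw [p1, e1]
    have c2 : (Polynomial.C (2 : ℝ)) = 2 := rfl
    have c3 : (Polynomial.C (3 : ℝ)) = 3 := rfl
    have c4 : (Polynomial.C (4 : ℝ)) = 4 := rfl
    simp [dP, c2, c3, c4]
    ring
  rw [p0, p1, p2, e0, e1, e2]
  simp [FP]
  ring

lemma pow_bd (x : ℝ) {k m : ℕ} (h : k ≤ 2 * m) : |x| ^ k ≤ 1 + x ^ (2 * m) := by
  have e : x ^ (2 * m) = |x| ^ (2 * m) := by rw [pow_mul, pow_mul, sq_abs]
  rw [e]
  rcases le_total |x| 1 with h1 | h1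
  · have := pow_le_one₀ (abs_nonneg x) h1 (n := k)
    have h3 : 0 ≤ |x| ^ (2 * m) := by positivity
    linarith
  · have := pow_le_pow_right₀ h1 h
    linarith

lemma term_gen {m t a : ℕ} (h : 2 ≤ m ∨ t ≤ 3) (ha : a + 1 ≤ t) (hm : t ≤ 2 * m + 1) :
    ∃ C : ℝ, ∀ ε, 0 < ε → ε ≤ 1 → ∀ x, |x ^ a * GG ε m t x| ≤ C * (1 + x ^ (2 * m)) := by
  obtain ⟨C, h0, hC⟩ := FP_bdd (PP m t)
  refine ⟨C, fun ε hε _ x => ?_⟩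
  rw [GG_gen h, abs_mul, abs_pow]
  calc |x| ^ a * |FP ε (2 * m + 1 - t) (PP m t) x|
      ≤ |x| ^ a * (C * |x| ^ (2 * m + 1 - t)) := by gcongr; exact hC _ hε _ _
    _ = C * |x| ^ (a + (2 * m + 1 - t)) := by rw [pow_add]; ring
    _ ≤ _ := by gcongr; exact pow_bd x (by omega)

lemma term_five {a : ℕ} (ha : a ≤ 2) :
    ∃ C : ℝ, ∀ ε, 0 < ε → ε ≤ 1 → ∀ x, |x ^ a * GG ε 1 5 x| ≤ C * (1 + x ^ (2 * 1)) := by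
  obtain ⟨C, h0, hC⟩ := FP_bdd (dP 1 QQ)
  refine ⟨2 * C, fun ε hε h1 x => ?_⟩
  rw [GG_five, abs_mul, abs_pow, abs_mul, abs_neg, abs_of_pos (by positivity : 0 < 2 * ε)]
  calc |x| ^ a * (2 * ε * |FP ε 0 (dP 1 QQ) x|)
      ≤ |x| ^ a * (2 * 1 * (C * |x| ^ 0)) := by gcongr; exact hC _ hε _ _
    _ = 2 * C * |x| ^ a := by simp; ring
    _ ≤ _ := by gcongr; exact pow_bd x (by omega)

lemma term_four_one :
    ∃ C : ℝ, ∀ ε, 0 < ε → ε ≤ 1 → ∀ x, |x ^ 1 * GG ε 1 4 x| ≤ C * (1 + x ^ (2 * 1)) := by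
  obtain ⟨C, h0, hC⟩ := FP_bdd QQ
  refine ⟨2 * C, fun ε hε h1 x => ?_⟩
  rw [GG_four, abs_mul, abs_pow, abs_mul, abs_neg, abs_of_pos (by positivity : 0 < 2 * ε)]
  calc |x| ^ 1 * (2 * ε * |FP ε 1 QQ x|)
      ≤ |x| ^ 1 * (2 * 1 * (C * |x| ^ 1)) := by gcongr; exact hC _ hε _ _
    _ = 2 * C * |x| ^ 2 := by ring
    _ ≤ _ := by gcongr; exact pow_bd x (by omega)

lemma term_four_three :
    ∃ C : ℝ, ∀ ε, 0 < ε → ε ≤ 1 → ∀ x, |x ^ 3 * GG ε 1 4 x| ≤ C * (1 + x ^ (2 * 1)) := by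
  obtain ⟨C, h0, hC⟩ := FP_bdd (Polynomial.X * Polynomial.derivative (PP 1 3))
  refine ⟨2 * C, fun ε hε h1 x => ?_⟩
  have key : x ^ 3 * GG ε 1 4 x = -(2 * (vv ε x * (ε * x ^ 2))) *
      FP ε 2 (Polynomial.X * Polynomial.derivative (PP 1 3)) x := by
    rw [GG_four]
    simp [FP, QQ]
    ring
  have hv := vv_pos hε x
  have hv1 := vv_le hε x
  rw [key, vv_rel hε, abs_mul, abs_neg, abs_of_nonneg (by linarith : 0 ≤ 2 * (1 - vv ε x))]
  calc 2 * (1 - vv ε x) * |FP ε 2 (Polynomial.X * Polynomial.derivative (PP 1 3)) x|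
      ≤ 2 * 1 * (C * |x| ^ 2) := by
        gcongr
        · linarith
        · exact hC _ hε _ _
    _ = 2 * C * |x| ^ 2 := by ring
    _ ≤ _ := by gcongr; exact pow_bd x (by omega)

lemma low_bdd {m : ℕ} (hm : 1 ≤ m) :
    ∃ K : ℝ, ∀ ε, 0 < ε → ε ≤ 1 → ∀ x, |lowT (GG ε m) x| ≤ K * (1 + x ^ (2 * m)) := by
  have h50 : ∃ C : ℝ, ∀ ε, 0 < ε → ε ≤ 1 → ∀ x, |x ^ 0 * GG ε m 5 x| ≤ C * (1 + x ^ (2 * m)) := by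
    rcases hm.eq_or_lt with rfl | h
    · exact term_five (by norm_num)
    · exact term_gen (by omega) (by omega) (by omega)
  have h52 : ∃ C : ℝ, ∀ ε, 0 < ε → ε ≤ 1 → ∀ x, |x ^ 2 * GG ε m 5 x| ≤ C * (1 + x ^ (2 * m)) := by
    rcases hm.eq_or_lt with rfl | h
    · exact term_five (by norm_num)
    · exact term_gen (by omega) (by omega) (by omega)
  have h43 : ∃ C : ℝ, ∀ ε, 0 < ε → ε ≤ 1 → ∀ x, |x ^ 3 * GG ε m 4 x| ≤ C * (1 + x ^ (2 * m)) := by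
    rcases hm.eq_or_lt with rfl | h
    · exact term_four_three
    · exact term_gen (by omega) (by omega) (by omega)
  have h41 : ∃ C : ℝ, ∀ ε, 0 < ε → ε ≤ 1 → ∀ x, |x ^ 1 * GG ε m 4 x| ≤ C * (1 + x ^ (2 * m)) := by
    rcases hm.eq_or_lt with rfl | h
    · exact term_four_one
    · exact term_gen (by omega) (by omega) (by omega)
  obtain ⟨c1, h1⟩ := h50
  obtain ⟨c2, h2⟩ := h52
  obtain ⟨c3, h3⟩ := h43
  obtain ⟨c4, h4⟩ := h41
  obtain ⟨c5, h5⟩ := term_gen (m := m) (t := 3) (a := 0) (by omega) (by omega) (by omega)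
  obtain ⟨c6, h6⟩ := term_gen (m := m) (t := 3) (a := 2) (by omega) (by omega) (by omega)
  obtain ⟨c7, h7⟩ := term_gen (m := m) (t := 2) (a := 1) (by omega) (by omega) (by omega)
  refine ⟨c1 + c2 + c3 + 4 * c4 + 5 * c5 + 2 * c6 + 21 * c7, fun ε hε he x => ?_⟩
  have b1 := abs_le.1 (h1 ε hε he x)
  have b2 := abs_le.1 (h2 ε hε he x)
  have b3 := abs_le.1 (h3 ε hε he x)
  have b4 := abs_le.1 (h4 ε hε he x)
  have b5 := abs_le.1 (h5 ε hε he x)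
  have b6 := abs_le.1 (h6 ε hε he x)
  have b7 := abs_le.1 (h7 ε hε he x)
  rw [pow_zero, one_mul] at b1 b5
  unfold lowT
  simp only [add_mul, mul_assoc]
  rw [abs_le]
  constructor <;> linarith [b1.1, b1.2, b2.1, b2.2, b3.1, b3.2, b4.1, b4.2, b5.1, b5.2, b6.1,
    b6.2, b7.1, b7.2]

lemma bootstrap (μ : Measure ℝ) [IsProbabilityMeasure μ]
    (h2 : Integrable (fun x : ℝ => x ^ 2) μ)
    (hS : ∀ f, memFGS f → ∫ x, steinGS f x ∂μ = 0) {m : ℕ} (hm : 1 ≤ m)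
    (hi : Integrable (fun x : ℝ => x ^ (2 * m)) μ) :
    Integrable (fun x : ℝ => x ^ (2 * (m + 1))) μ := by
  obtain ⟨K, hK⟩ := low_bdd hm
  have hB : Integrable (fun x : ℝ => K * (1 + x ^ (2 * m))) μ :=
    ((integrable_const 1).add hi).const_mul K
  have hmain_cont : ∀ ε, 0 < ε → Continuous (mainT (GG ε m)) := by
    intro ε hε
    have hc := (GG_chain hε hm).cont
    have c0 := hc 0 (by norm_num)
    have c1 := hc 1 (by norm_num)
    have c2 := hc 2 (by norm_num)
    unfold mainT
    fun_prop
  have hlow_cont : ∀ ε, 0 < ε → Continuous (lowT (GG ε m)) := by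
    intro ε hε
    have hc := (GG_chain hε hm).cont
    have c2 := hc 2 (by norm_num)
    have c3 := hc 3 (by norm_num)
    have c4 := hc 4 (by norm_num)
    have c5 := hc 5 (by norm_num)
    unfold lowT
    fun_prop
  have hmain_nn : ∀ ε, 0 < ε → ∀ x, 0 ≤ mainT (GG ε m) x := by
    intro ε hε x
    rw [GG_main hε hm]
    have := vv_pos hε x
    have e : x ^ (2 * m + 2) = (x ^ (m + 1)) ^ 2 := by rw [← pow_mul]; ring
    rw [e]
    positivity
  have hmain_int : ∀ ε, 0 < ε → Integrable (mainT (GG ε m)) μ := by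
    intro ε hε
    refine (h2.const_mul (12 * m * (ε⁻¹) ^ m * (m + 2))).mono'
      (hmain_cont ε hε).aestronglyMeasurable (Filter.Eventually.of_forall fun x => ?_)
    rw [Real.norm_of_nonneg (hmain_nn ε hε x), GG_main hε hm]
    have hv := vv_pos hε x
    have hv1 := vv_le hε x
    have hr := vv_rel hε x
    have hxv : x ^ 2 * vv ε x ≤ ε⁻¹ := by
      rw [← one_div, le_div_iff₀ hε]
      linarith
    calc 12 * m * x ^ (2 * m + 2) * vv ε x ^ (m + 1) * (1 + (m + 1) * vv ε x)
        = 12 * m * (x ^ 2 * vv ε x) ^ m * (vv ε x * (1 + (m + 1) * vv ε x)) * x ^ 2 := by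
          rw [mul_pow, ← pow_mul]; ring
      _ ≤ 12 * m * (ε⁻¹) ^ m * (1 * (1 + (m + 1) * 1)) * x ^ 2 := by gcongr
      _ = _ := by ring
  have hlow_int : ∀ ε, 0 < ε → ε ≤ 1 → Integrable (lowT (GG ε m)) μ := by
    intro ε hε h1
    exact hB.mono' (hlow_cont ε hε).aestronglyMeasurable
      (Filter.Eventually.of_forall fun x => hK ε hε h1 x)
  have hbd : ∀ ε, 0 < ε → ε ≤ 1 →
      ∫ x, mainT (GG ε m) x ∂μ ≤ ∫ x, K * (1 + x ^ (2 * m)) ∂μ := by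
    intro ε hε h1
    have hch := GG_chain hε hm
    have h := hS _ hch.mem
    rw [hch.stein] at h
    simp only [stF_split] at h
    rw [integral_add (hmain_int ε hε) (hlow_int ε hε h1)] at h
    have : ∫ x, mainT (GG ε m) x ∂μ = ∫ x, - lowT (GG ε m) x ∂μ := by
      rw [integral_neg]; linarith
    rw [this]
    apply integral_mono (hlow_int ε hε h1).neg hB
    intro x
    have := abs_le.1 (hK ε hε h1 x)
    show - lowT (GG ε m) x ≤ _
    linarith [this.1]
  set e : ℕ → ℝ := fun n => 1 / ((n : ℝ) + 1) with he
  have epos : ∀ n, 0 < e n := fun n => by simp only [he]; positivity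
  have ele : ∀ n, e n ≤ 1 := fun n => by
    simp only [he]
    rw [div_le_one (by positivity)]
    have : (0 : ℝ) ≤ n := by positivity
    linarith
  have elim : Tendsto e atTop (𝓝 0) := tendsto_one_div_add_atTop_nhds_zero_nat
  have hfin : Integrable (fun x : ℝ => 12 * m * x ^ (2 * m + 2) * 1 ^ (m + 1) *
      (1 + (m + 1) * 1)) μ := by
    apply integrable_of_tendsto (G := fun n => mainT (GG (e n) m))
    · refine Filter.Eventually.of_forall fun x => ?_
      have hv : Tendsto (fun n => vv (e n) x) atTop (𝓝 1) := by
        unfold vv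
        have h1 : Tendsto (fun n => 1 + e n * x ^ 2) atTop (𝓝 (1 + 0 * x ^ 2)) :=
          tendsto_const_nhds.add (elim.mul_const _)
        have := h1.inv₀ (by simp)
        simpa using this
      simp only [GG_main (epos _) hm]
      exact ((hv.pow (m + 1)).const_mul _).mul ((hv.const_mul _).const_add 1)
    · intro n
      exact (hmain_cont _ (epos n)).aestronglyMeasurable
    · have hle : ∀ n, ∫⁻ x, ‖mainT (GG (e n) m) x‖ₑ ∂μ ≤
          ENNReal.ofReal (∫ x, K * (1 + x ^ (2 * m)) ∂μ) := by
        intro n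
        rw [← ofReal_integral_norm_eq_lintegral_enorm (hmain_int _ (epos n))]
        apply ENNReal.ofReal_le_ofReal
        refine le_trans (le_of_eq ?_) (hbd _ (epos n) (ele n))
        congr 1
        ext x
        exact Real.norm_of_nonneg (hmain_nn _ (epos n) x)
      have h3 := Filter.liminf_le_liminf (f := atTop) (Filter.Eventually.of_forall hle)
      rw [Filter.liminf_const] at h3
      exact (h3.trans_lt ENNReal.ofReal_lt_top).ne
  have hc : (12 * m * (m + 2) : ℝ) ≠ 0 := by
    have : (0 : ℝ) < m := by exact_mod_cast hm
    positivity
  refine (hfin.const_mul (12 * m * (m + 2) : ℝ)⁻¹).congr (Filter.Eventually.of_forall fun x => ?_)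
  simp only [one_pow, mul_one]
  rw [show 2 * (m + 1) = 2 * m + 2 by ring]
  field_simp
  ring

lemma all_moments (μ : Measure ℝ) [IsProbabilityMeasure μ]
    (h2 : Integrable (fun x : ℝ => x ^ 2) μ)
    (hS : ∀ f, memFGS f → ∫ x, steinGS f x ∂μ = 0) (n : ℕ) :
    Integrable (fun x : ℝ => x ^ n) μ := by
  have hev : ∀ m : ℕ, Integrable (fun x : ℝ => x ^ (2 * (m + 1))) μ := by
    intro m
    induction m with
    | zero => simpa using h2
    | succ k ih => exact bootstrap μ h2 hS (by omega) ih
  refine ((integrable_const (1 : ℝ)).add (hev n)).mono' (by fun_prop)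
    (Filter.Eventually.of_forall fun x => ?_)
  rw [Real.norm_eq_abs, abs_pow]
  exact pow_bd x (by omega)

/-- if `W` has `E[W²] = 1/4` and `E[S f(W)] = 0` for all `f ∈ F`, then
`W` is semicircular. -/
theorem steinGS_characterises_semicircle_with_second_moment_quarter
    {Ω : Type*} [MeasurableSpace Ω] (ν : Measure Ω) [IsProbabilityMeasure ν]
    (W : Ω → ℝ) (hW : Measurable W)
    (hW2 : Integrable (fun ω => (W ω) ^ 2) ν)
    (hW2eq : ∫ ω, (W ω) ^ 2 ∂ν = 1 / 4)
    (hSW : ∀ f : ℝ → ℝ, memFGS f → ∫ ω, steinGS f (W ω) ∂ν = 0) :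
    Measure.map W ν = semicircle := by

  have hp : IsProbabilityMeasure (Measure.map W ν) :=
    Measure.isProbabilityMeasure_map hW.aemeasurable
  have hmap : ∀ g : ℝ → ℝ, Continuous g → ∫ x, g x ∂(Measure.map W ν) = ∫ ω, g (W ω) ∂ν :=
    fun g hg => integral_map hW.aemeasurable hg.aestronglyMeasurable
  have h2 : Integrable (fun x : ℝ => x ^ 2) (Measure.map W ν) :=
    (integrable_map_measure (by fun_prop) hW.aemeasurable).2 hW2
  have h2e : ∫ x, x ^ 2 ∂(Measure.map W ν) = 1 / 4 := by
    rw [hmap _ (by fun_prop)]; exact hW2eq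
  have hS : ∀ f, memFGS f → ∫ x, steinGS f x ∂(Measure.map W ν) = 0 := by
    intro f hf
    rw [hmap]
    · exact hSW f hf
    · have hc := hf.1
      have c0 := hc.continuous
      have c1 := hc.continuous_deriv (by norm_num)
      have c2 := hc.continuous_iteratedDeriv 2 (by norm_num)
      have c3 := hc.continuous_iteratedDeriv 3 (by norm_num)
      have c4 := hc.continuous_iteratedDeriv 4 (by norm_num)
      have c5 := hc.continuous_iteratedDeriv 5 (by norm_num)
      unfold steinGS
      fun_prop
  have hall := all_moments _ h2 hS
  exact determine _ hall (moments_eq _ hall h2e hS)
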